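/- For all ν ≥ 1/2 and all x ∈ (0, 1], the inequality I_ν(x) K_ν(x) / (1 + |ln x|) ≤ I_ν(1) K_ν(1) holds; moreover for x ≥ 1 the same inequality holds for all ν > -1. -/

import Mathlib

open Real MeasureTheory Set Filter

/-- Modified Bessel function of the first kind `I_ν`. -/
noncomputable def besselI (ν x : ℝ) : ℝ :=
  ∑' n : ℕ, (x / 2) ^ (2 * (n : ℝ) + ν) / ((n.factorial : ℝ) * Real.Gamma ((n : ℝ) + ν + 1))

/-- Modified Bessel function of the second kind `K_ν`. -/
noncomputable def besselK (ν x : ℝ) : ℝ :=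
  ∫ t in Ioi (0 : ℝ), Real.exp (-x * Real.cosh t) * Real.cosh (ν * t)

/-- Bessel function of the first kind `J_ν`. -/
noncomputable def besselJ (ν x : ℝ) : ℝ :=
  ∑' n : ℕ, (-1 : ℝ) ^ n * (x / 2) ^ (2 * (n : ℝ) + ν) /
    ((n.factorial : ℝ) * Real.Gamma ((n : ℝ) + ν + 1))

/-- Modified Struve function of the first kind `L_ν`. -/
noncomputable def struveL (ν x : ℝ) : ℝ :=
  ∑' n : ℕ, (x / 2) ^ (2 * (n : ℝ) + ν + 1) /
    (Real.Gamma ((n : ℝ) + 3 / 2) * Real.Gamma ((n : ℝ) + ν + 3 / 2))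

/-- Airy function `Ai`. -/
noncomputable def airyAi (t : ℝ) : ℝ :=
  (1 / Real.pi) * ∫ s in Ioi (0 : ℝ), Real.cos (s ^ 3 / 3 + s * t)

/-- Landau constant `b_L = 2^{1/3} ⬝ sup_{t ≥ 0} Ai(t)`. -/
noncomputable def landau_bL : ℝ :=
  (2 : ℝ) ^ ((1 : ℝ) / 3) * sSup (airyAi '' Ici 0)

/-- Landau constant `c_L = sup_{t ≥ 0} t^{1/3} J₀(t)`. -/
noncomputable def landau_cL : ℝ :=
  sSup ((fun t : ℝ => t ^ ((1 : ℝ) / 3) * besselJ 0 t) '' Ici 0)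

section BesselI

/-- Taylor coefficients of `x ↦ (x / 2) ^ (-ν) * I_ν(x)` in the variable `(x / 2) ^ 2`. -/
noncomputable def besselCoeff (ν : ℝ) (n : ℕ) : ℝ :=
  ((n.factorial : ℝ) * Real.Gamma ((n : ℝ) + ν + 1))⁻¹

variable {ν x y : ℝ}

lemma Gamma_natCast_add_pos (hν : -1 < ν) (n : ℕ) : 0 < Real.Gamma ((n : ℝ) + ν + 1) :=
  Real.Gamma_pos_of_pos (by have : (0 : ℝ) ≤ n := n.cast_nonneg; linarith)

lemma besselCoeff_pos (hν : -1 < ν) (n : ℕ) : 0 < besselCoeff ν n := by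
  have := Gamma_natCast_add_pos hν n
  unfold besselCoeff
  positivity

lemma besselCoeff_succ (hν : -1 < ν) (n : ℕ) :
    ((n : ℝ) + 1) * ((n : ℝ) + 1 + ν) * besselCoeff ν (n + 1) = besselCoeff ν n := by
  have h0 : (0 : ℝ) ≤ n := n.cast_nonneg
  have h1 : (n : ℝ) + ν + 1 ≠ 0 := by linarith
  have h2 := (Gamma_natCast_add_pos hν n).ne'
  have h3 : Real.Gamma (((n + 1 : ℕ) : ℝ) + ν + 1)
      = ((n : ℝ) + ν + 1) * Real.Gamma ((n : ℝ) + ν + 1) := by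
    rw [← Real.Gamma_add_one h1]; congr 1; push_cast; ring
  have h4 : (n : ℝ) + 1 ≠ 0 := by linarith
  have h5 : (n.factorial : ℝ) ≠ 0 := by positivity
  have h6 : (n : ℝ) + 1 + ν ≠ 0 := by linarith
  unfold besselCoeff
  rw [h3, Nat.factorial_succ]
  push_cast
  field_simp
  ring

lemma exists_Gamma_natCast_add_ge (hν : -1 < ν) :
    ∃ m > 0, ∀ n : ℕ, m ≤ Real.Gamma ((n : ℝ) + ν + 1) := by
  have hp := Gamma_natCast_add_pos hν
  have key : ∀ n : ℕ, Real.Gamma (((1 : ℕ) : ℝ) + ν + 1)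
      ≤ Real.Gamma (((n + 1 : ℕ) : ℝ) + ν + 1) := by
    intro n
    induction n with
    | zero => simp
    | succ k ih =>
      have h0 : (0 : ℝ) ≤ k := k.cast_nonneg
      have h1 : ((k + 1 : ℕ) : ℝ) + ν + 1 ≠ 0 := by push_cast; linarith
      have h3 : Real.Gamma (((k + 1 + 1 : ℕ) : ℝ) + ν + 1)
          = (((k + 1 : ℕ) : ℝ) + ν + 1) * Real.Gamma (((k + 1 : ℕ) : ℝ) + ν + 1) := by
        rw [← Real.Gamma_add_one h1]; congr 1; push_cast; ring
      rw [h3]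
      refine ih.trans (le_mul_of_one_le_left (hp _).le ?_)
      push_cast; linarith
  refine ⟨min (Real.Gamma (((0 : ℕ) : ℝ) + ν + 1)) (Real.Gamma (((1 : ℕ) : ℝ) + ν + 1)),
    lt_min (hp 0) (hp 1), fun n => ?_⟩
  cases n with
  | zero => exact min_le_left _ _
  | succ k => exact (min_le_right _ _).trans (key k)

lemma summable_sq_mul_besselCoeff_mul_pow (hν : -1 < ν) (hy : 0 ≤ y) :
    Summable fun n : ℕ => (n : ℝ) ^ 2 * (besselCoeff ν n * y ^ n) := by
  obtain ⟨m, hm, hG⟩ := exists_Gamma_natCast_add_ge hν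
  refine Summable.of_nonneg_of_le (fun n => ?_) (fun n => ?_)
    ((Real.summable_pow_div_factorial (4 * y)).mul_left m⁻¹)
  · have := besselCoeff_pos hν n
    positivity
  · have hc := besselCoeff_pos hν n
    have h1 : besselCoeff ν n ≤ m⁻¹ * (n.factorial : ℝ)⁻¹ := by
      unfold besselCoeff
      rw [mul_inv, mul_comm]
      gcongr
      exact hG n
    have h2 : (n : ℝ) ^ 2 ≤ 4 ^ n := by
      have : (n : ℝ) ≤ 2 ^ n := by exact_mod_cast n.lt_two_pow_self.le
      calc (n : ℝ) ^ 2 ≤ (2 ^ n) ^ 2 := by gcongr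
        _ = 4 ^ n := by rw [← pow_mul, mul_comm, pow_mul]; norm_num
    calc (n : ℝ) ^ 2 * (besselCoeff ν n * y ^ n)
        ≤ 4 ^ n * (m⁻¹ * (n.factorial : ℝ)⁻¹ * y ^ n) := by gcongr
      _ = m⁻¹ * ((4 * y) ^ n / n.factorial) := by rw [mul_pow]; ring

lemma summable_mul_besselCoeff_mul_pow (hν : -1 < ν) (hy : 0 ≤ y) :
    Summable fun n : ℕ => (n : ℝ) * (besselCoeff ν n * y ^ n) := by
  refine Summable.of_nonneg_of_le (fun n => ?_) (fun n => ?_)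
    (summable_sq_mul_besselCoeff_mul_pow hν hy)
  · have := besselCoeff_pos hν n
    positivity
  · have := besselCoeff_pos hν n
    gcongr
    exact_mod_cast Nat.le_self_pow two_ne_zero n

lemma summable_besselCoeff_mul_pow (hν : -1 < ν) (hy : 0 ≤ y) :
    Summable fun n : ℕ => besselCoeff ν n * y ^ n := by
  rw [← summable_nat_add_iff 1]
  refine Summable.of_nonneg_of_le (fun n => ?_) (fun n => ?_)
    ((summable_nat_add_iff 1).2 (summable_mul_besselCoeff_mul_pow hν hy))
  · have := besselCoeff_pos hν (n + 1)
    positivity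
  · have := besselCoeff_pos hν (n + 1)
    refine le_mul_of_one_le_left (by positivity) ?_
    push_cast
    linarith [n.cast_nonneg (α := ℝ)]

lemma tsum_sq_mul_besselCoeff (hν : -1 < ν) (hy : 0 ≤ y) :
    ∑' n : ℕ, (n : ℝ) ^ 2 * (besselCoeff ν n * y ^ n)
      + ν * ∑' n : ℕ, (n : ℝ) * (besselCoeff ν n * y ^ n)
      = y * ∑' n : ℕ, besselCoeff ν n * y ^ n := by
  have h1 := summable_mul_besselCoeff_mul_pow hν hy
  have h2 := summable_sq_mul_besselCoeff_mul_pow hν hy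
  rw [← tsum_mul_left, ← tsum_mul_left, ← h2.tsum_add (h1.mul_left ν),
    (h2.add (h1.mul_left ν)).tsum_eq_zero_add]
  simp only [Nat.cast_zero, zero_mul, mul_zero, ne_eq, OfNat.ofNat_ne_zero, not_false_eq_true,
    zero_pow, add_zero, zero_add]
  refine tsum_congr fun n => ?_
  rw [← besselCoeff_succ hν n]
  push_cast
  ring

lemma hasDerivAt_tsum_besselCoeff (hν : -1 < ν) (hy : 0 < y) :
    HasDerivAt (fun z => ∑' n : ℕ, besselCoeff ν n * z ^ n)
      (y⁻¹ * ∑' n : ℕ, (n : ℝ) * (besselCoeff ν n * y ^ n)) y := by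
  have hu := (summable_mul_besselCoeff_mul_pow hν (y := 2 * y) (by positivity)).mul_left (2 / y)
  have key := hasDerivAt_tsum_of_isPreconnected
    (g := fun (n : ℕ) z => besselCoeff ν n * z ^ n)
    (g' := fun (n : ℕ) z => z⁻¹ * ((n : ℝ) * (besselCoeff ν n * z ^ n)))
    (t := Ioo (y / 2) (2 * y)) (y₀ := y) (y := y) hu isOpen_Ioo isPreconnected_Ioo ?_ ?_ ?_
    (summable_besselCoeff_mul_pow hν hy.le) ?_
  · rwa [tsum_mul_left] at key
  · intro n z hz
    have hz0 : z ≠ 0 := by have := hz.1; linarith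
    refine ((hasDerivAt_pow n z).const_mul (besselCoeff ν n)).congr_deriv ?_
    cases n with
    | zero => simp
    | succ k => simp only [Nat.add_sub_cancel, pow_succ]; field_simp
  · intro n z hz
    have hz0 : 0 < z := by have := hz.1; linarith
    have hc := besselCoeff_pos hν n
    rw [Real.norm_of_nonneg (by positivity)]
    have h1 : z⁻¹ ≤ 2 / y := by
      rw [inv_eq_one_div, div_le_div_iff₀ hz0 hy]; linarith [hz.1]
    have h2 := hz.2.le
    gcongr
  · constructor <;> linarith
  · constructor <;> linarith

lemma besselI_eq (hx : 0 < x) :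
    besselI ν x = (x / 2) ^ ν * ∑' n : ℕ, besselCoeff ν n * ((x / 2) ^ 2) ^ n := by
  rw [besselI, ← tsum_mul_left]
  refine tsum_congr fun n => ?_
  rw [Real.rpow_add (by positivity), besselCoeff, ← pow_mul, div_eq_mul_inv]
  norm_cast
  ring

lemma besselI_nonneg (hν : -1 < ν) (hx : 0 < x) : 0 ≤ besselI ν x := by
  rw [besselI_eq hx]
  exact mul_nonneg (by positivity)
    (tsum_nonneg fun n => mul_nonneg (besselCoeff_pos hν n).le (by positivity))

/-- The logarithmic derivative of `I_ν` lies between `ν / x` and `√(x² + ν²) / x`. -/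
lemma exists_hasDerivAt_besselI (hν : -1 < ν) (hx : 0 < x) :
    ∃ d, HasDerivAt (besselI ν) d x ∧ ν * besselI ν x ≤ x * d ∧
      x * d ≤ √(x ^ 2 + ν ^ 2) * besselI ν x := by
  have hy : 0 < (x / 2) ^ 2 := by positivity
  have hs0 := summable_besselCoeff_mul_pow hν hy.le
  have hs1 := summable_mul_besselCoeff_mul_pow hν hy.le
  have hs2 := summable_sq_mul_besselCoeff_mul_pow hν hy.le
  have hrec := tsum_sq_mul_besselCoeff hν hy.le
  have hderiv := hasDerivAt_tsum_besselCoeff hν hy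
  have hI := besselI_eq (ν := ν) hx
  have hpos : ∀ n : ℕ, 0 ≤ besselCoeff ν n * ((x / 2) ^ 2) ^ n := fun n =>
    mul_nonneg (besselCoeff_pos hν n).le (by positivity)
  have hS1 : 0 ≤ ∑' n : ℕ, (n : ℝ) * (besselCoeff ν n * ((x / 2) ^ 2) ^ n) :=
    tsum_nonneg fun n => mul_nonneg n.cast_nonneg (hpos n)
  have hR : x ^ 2 + ν ^ 2 = √(x ^ 2 + ν ^ 2) ^ 2 := (Real.sq_sqrt (by positivity)).symm
  have hR0 : 0 < √(x ^ 2 + ν ^ 2) := Real.sqrt_pos.2 (by positivity)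
  set R := √(x ^ 2 + ν ^ 2)
  have hsum := ((hs0.hasSum.mul_left ((R - ν) ^ 2)).sub (hs1.hasSum.mul_left (4 * (R - ν)))).add
    (hs2.hasSum.mul_left 4)
  have hsq := hsum.nonneg fun n => by
    have : 0 ≤ (R - ν - 2 * n) ^ 2 * (besselCoeff ν n * ((x / 2) ^ 2) ^ n) :=
      mul_nonneg (sq_nonneg _) (hpos n)
    linarith
  set S0 := ∑' n : ℕ, besselCoeff ν n * ((x / 2) ^ 2) ^ n
  set S1 := ∑' n : ℕ, (n : ℝ) * (besselCoeff ν n * ((x / 2) ^ 2) ^ n)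
  set S2 := ∑' n : ℕ, (n : ℝ) ^ 2 * (besselCoeff ν n * ((x / 2) ^ 2) ^ n)
  have hp : 0 < (x / 2) ^ ν := by positivity
  have hd2 : HasDerivAt (fun z : ℝ => (z / 2) ^ 2) (x / 2) x := by
    refine (((hasDerivAt_id x).div_const 2).pow 2).congr_deriv ?_
    simp
    ring
  have hd1 : HasDerivAt (fun z : ℝ => (z / 2) ^ ν) (ν / x * (x / 2) ^ ν) x := by
    refine (((hasDerivAt_id x).div_const 2).rpow_const (p := ν)
      (Or.inl (by simp [hx.ne']))).congr_deriv ?_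
    simp only [id]
    rw [Real.rpow_sub_one (by positivity)]
    field_simp
  have hd := hd1.mul (hderiv.comp x hd2)
  refine ⟨_, hd.congr_of_eventuallyEq ?_, ?_⟩
  · filter_upwards [lt_mem_nhds hx] with z hz
    rw [besselI_eq hz]
    rfl
  · have e : x * (ν / x * (x / 2) ^ ν * S0 + (x / 2) ^ ν * (((x / 2) ^ 2)⁻¹ * S1 * (x / 2)))
        = (x / 2) ^ ν * (ν * S0 + 2 * S1) := by
      field_simp
    simp only [Function.comp_def]
    rw [e, hI]
    have hle : ν * S0 + 2 * S1 ≤ R * S0 := by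
      have : 0 ≤ 2 * R * (R * S0 - (ν * S0 + 2 * S1)) := by
        have e2 : 4 * S2 = x ^ 2 * S0 - 4 * ν * S1 := by linear_combination 4 * hrec
        rw [e2] at hsq
        have e3 : x ^ 2 = R ^ 2 - ν ^ 2 := by linarith
        rw [e3] at hsq
        linarith
      have := nonneg_of_mul_nonneg_right this (by positivity)
      linarith
    constructor
    · nlinarith [mul_nonneg hp.le hS1]
    · nlinarith [mul_le_mul_of_nonneg_left hle hp.le]

end BesselI

section BesselK

variable {ν x m : ℝ}

lemma sq_div_four_le_cosh {t : ℝ} (ht : 0 ≤ t) : t ^ 2 / 4 ≤ Real.cosh t := by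
  rw [Real.cosh_eq]
  have := Real.quadratic_le_exp_of_nonneg ht
  have := Real.exp_pos (-t)
  linarith

lemma cosh_mul_le_exp (ν : ℝ) {t : ℝ} (ht : 0 ≤ t) :
    Real.cosh (ν * t) ≤ Real.exp (|ν| * t) := by
  have h : Real.cosh (ν * t) = Real.cosh (|ν| * t) := by
    rw [← Real.cosh_abs, abs_mul, abs_of_nonneg ht]
  have h1 : Real.exp (-(|ν| * t)) ≤ Real.exp (|ν| * t) := by
    have : 0 ≤ |ν| * t := by positivity
    gcongr
    linarith
  rw [h, Real.cosh_eq]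
  linarith

lemma cosh_le_exp {t : ℝ} (ht : 0 ≤ t) : Real.cosh t ≤ Real.exp t := by
  simpa using cosh_mul_le_exp 1 ht

lemma abs_sinh_le_cosh (t : ℝ) : |Real.sinh t| ≤ Real.cosh t := by
  rw [Real.abs_sinh, ← Real.cosh_abs]
  exact (Real.sinh_lt_cosh _).le

lemma abs_exp_neg_mul_cosh_mul_le (hx : 0 < x) {h : ℝ → ℝ}
    (hb : ∀ t, 0 ≤ t → |h t| ≤ Real.exp (m * t)) {t : ℝ} (ht : 0 ≤ t) :
    |Real.exp (-x * Real.cosh t) * h t| ≤ Real.exp ((m + 1) ^ 2 / x) * Real.exp (-t) := by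
  rw [abs_mul, abs_of_pos (Real.exp_pos _)]
  refine (mul_le_mul_of_nonneg_left (hb t ht) (Real.exp_pos _).le).trans ?_
  rw [← Real.exp_add, ← Real.exp_add]
  refine Real.exp_le_exp.2 ?_
  have h1 := mul_le_mul_of_nonneg_left (sq_div_four_le_cosh ht) hx.le
  have h2 : (m + 1) * t ≤ (m + 1) ^ 2 / x + x * (t ^ 2 / 4) := by
    have h3 : (m + 1) ^ 2 / x + x * (t ^ 2 / 4) - (m + 1) * t
        = (m + 1 - x * t / 2) ^ 2 / x := by
      field_simp; ring
    have h4 : 0 ≤ (m + 1 - x * t / 2) ^ 2 / x := by positivity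
    linarith
  linarith

lemma integrableOn_exp_neg_mul_cosh_mul (hx : 0 < x) {h : ℝ → ℝ} (hc : Continuous h)
    (hb : ∀ t, 0 ≤ t → |h t| ≤ Real.exp (m * t)) :
    IntegrableOn (fun t => Real.exp (-x * Real.cosh t) * h t) (Ioi 0) := by
  refine Integrable.mono' ((integrableOn_exp_neg_Ioi 0).const_mul (Real.exp ((m + 1) ^ 2 / x)))
    (Continuous.aestronglyMeasurable (by fun_prop)) ?_
  filter_upwards [ae_restrict_mem measurableSet_Ioi] with t ht
  exact abs_exp_neg_mul_cosh_mul_le hx hb (le_of_lt ht)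

lemma abs_cosh_mul_le (ν : ℝ) {t : ℝ} (ht : 0 ≤ t) :
    |Real.cosh (ν * t)| ≤ Real.exp (|ν| * t) := by
  rw [abs_of_pos (Real.cosh_pos _)]
  exact cosh_mul_le_exp ν ht

lemma abs_cosh_mul_cosh_le (ν : ℝ) {t : ℝ} (ht : 0 ≤ t) :
    |Real.cosh t * Real.cosh (ν * t)| ≤ Real.exp ((1 + |ν|) * t) := by
  rw [abs_of_pos (mul_pos (Real.cosh_pos _) (Real.cosh_pos _)), add_mul, one_mul, Real.exp_add]
  exact mul_le_mul (cosh_le_exp ht) (cosh_mul_le_exp ν ht) (Real.cosh_pos _).le (Real.exp_pos _).le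

lemma abs_sinh_mul_sinh_le (ν : ℝ) {t : ℝ} (ht : 0 ≤ t) :
    |Real.sinh t * Real.sinh (ν * t)| ≤ Real.exp ((1 + |ν|) * t) := by
  refine le_trans ?_ (abs_cosh_mul_cosh_le ν ht)
  rw [abs_mul, abs_mul, abs_of_pos (Real.cosh_pos _), abs_of_pos (Real.cosh_pos (ν * t))]
  exact mul_le_mul (abs_sinh_le_cosh _) (abs_sinh_le_cosh _) (abs_nonneg _) (Real.cosh_pos _).le

lemma integrableOn_besselK (ν : ℝ) (hx : 0 < x) :
    IntegrableOn (fun t => Real.exp (-x * Real.cosh t) * Real.cosh (ν * t)) (Ioi 0) :=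
  integrableOn_exp_neg_mul_cosh_mul hx (by fun_prop) fun _ => abs_cosh_mul_le ν

lemma integrableOn_cosh_mul_cosh (ν : ℝ) (hx : 0 < x) :
    IntegrableOn (fun t => Real.exp (-x * Real.cosh t) * (Real.cosh t * Real.cosh (ν * t)))
      (Ioi 0) :=
  integrableOn_exp_neg_mul_cosh_mul hx (by fun_prop) fun _ => abs_cosh_mul_cosh_le ν

lemma integrableOn_sinh_mul_sinh (ν : ℝ) (hx : 0 < x) :
    IntegrableOn (fun t => Real.exp (-x * Real.cosh t) * (Real.sinh t * Real.sinh (ν * t)))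
      (Ioi 0) :=
  integrableOn_exp_neg_mul_cosh_mul hx (by fun_prop) fun _ => abs_sinh_mul_sinh_le ν

lemma besselK_nonneg (ν x : ℝ) : 0 ≤ besselK ν x :=
  setIntegral_nonneg measurableSet_Ioi fun _ _ =>
    mul_nonneg (Real.exp_pos _).le (Real.cosh_pos _).le

lemma hasDerivAt_besselK (ν : ℝ) (hx : 0 < x) :
    HasDerivAt (besselK ν)
      (-∫ t in Ioi (0 : ℝ), Real.exp (-x * Real.cosh t) * (Real.cosh t * Real.cosh (ν * t))) x := by
  rw [← integral_neg]
  refine (hasDerivAt_integral_of_dominated_loc_of_deriv_le (s := Ioi (x / 2))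
    (bound := fun t => Real.exp (-(x / 2) * Real.cosh t) * (Real.cosh t * Real.cosh (ν * t)))
    (F := fun x t => Real.exp (-x * Real.cosh t) * Real.cosh (ν * t))
    (F' := fun x t => -(Real.exp (-x * Real.cosh t) * (Real.cosh t * Real.cosh (ν * t))))
    (Ioi_mem_nhds (by linarith)) (Eventually.of_forall fun z => ?_) (integrableOn_besselK ν hx)
    ?_ (Eventually.of_forall fun t z hz => ?_) (integrableOn_cosh_mul_cosh ν (by positivity))
    (Eventually.of_forall fun t z hz => ?_)).2
  · exact Continuous.aestronglyMeasurable (by fun_prop)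
  · exact Continuous.aestronglyMeasurable (by fun_prop)
  · have h1 := Real.cosh_pos t
    have h2 := Real.cosh_pos (ν * t)
    rw [norm_neg, Real.norm_of_nonneg (by positivity)]
    have h3 : x / 2 ≤ z := le_of_lt hz
    gcongr
  · have := (((hasDerivAt_id z).neg.mul_const (Real.cosh t)).exp).mul_const (Real.cosh (ν * t))
    refine this.congr_deriv ?_
    simp
    ring

lemma mul_integral_sinh_mul_sinh (ν : ℝ) (hx : 0 < x) :
    x * ∫ t in Ioi (0 : ℝ), Real.exp (-x * Real.cosh t) * (Real.sinh t * Real.sinh (ν * t))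
      = ν * besselK ν x := by
  have hd : ∀ t ∈ Ici (0 : ℝ), HasDerivAt (fun t => Real.exp (-x * Real.cosh t) * Real.sinh (ν * t))
      (ν * (Real.exp (-x * Real.cosh t) * Real.cosh (ν * t))
        - x * (Real.exp (-x * Real.cosh t) * (Real.sinh t * Real.sinh (ν * t)))) t := by
    intro t _
    have := (((Real.hasDerivAt_cosh t).const_mul (-x)).exp).mul
      (((hasDerivAt_id t).const_mul ν).sinh)
    refine this.congr_deriv ?_
    simp
    ring
  have hi1 := (integrableOn_besselK ν hx).const_mul ν
  have hi2 := (integrableOn_sinh_mul_sinh ν hx).const_mul x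
  have hlim : Tendsto (fun t => Real.exp (-x * Real.cosh t) * Real.sinh (ν * t)) atTop (nhds 0) := by
    refine squeeze_zero_norm' (a := fun t => Real.exp ((|ν| + 1) ^ 2 / x) * Real.exp (-t)) ?_ ?_
    · filter_upwards [eventually_ge_atTop 0] with t ht
      refine abs_exp_neg_mul_cosh_mul_le hx (h := fun t => Real.sinh (ν * t)) (fun s hs => ?_) ht
      exact (abs_sinh_le_cosh _).trans (cosh_mul_le_exp ν hs)
    · simpa using Real.tendsto_exp_neg_atTop_nhds_zero.const_mul (Real.exp ((|ν| + 1) ^ 2 / x))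
  have := integral_Ioi_of_hasDerivAt_of_tendsto' hd (hi1.sub hi2) hlim
  rw [integral_sub hi1 hi2, integral_const_mul, integral_const_mul] at this
  simp only [mul_zero, Real.sinh_zero, sub_zero] at this
  rw [besselK]
  linarith

/-- The logarithmic derivative of `K_ν` is at most `-√(x² + ν²) / x`, and at least `-(x + ν) / x`
when `ν ≥ 1 / 2`. -/
lemma exists_hasDerivAt_besselK (ν : ℝ) (hx : 0 < x) :
    ∃ d, HasDerivAt (besselK ν) d x ∧ √(x ^ 2 + ν ^ 2) * besselK ν x ≤ -(x * d) ∧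
      (1 / 2 ≤ ν → -(x * d) ≤ (x + ν) * besselK ν x) := by
  refine ⟨_, hasDerivAt_besselK ν hx, ?_, fun hν => ?_⟩
  · have hR : x ^ 2 + ν ^ 2 = √(x ^ 2 + ν ^ 2) ^ 2 := (Real.sq_sqrt (by positivity)).symm
    have hR0 : 0 < √(x ^ 2 + ν ^ 2) := Real.sqrt_pos.2 (by positivity)
    set R := √(x ^ 2 + ν ^ 2)
    have hB := mul_integral_sinh_mul_sinh ν hx
    have hK : besselK ν x
      = ∫ t in Ioi (0 : ℝ), Real.exp (-x * Real.cosh t) * Real.cosh (ν * t) := rfl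
    have hiA := (integrableOn_cosh_mul_cosh ν hx).const_mul R
    have hiK := (integrableOn_besselK ν hx).const_mul x
    have hiB := (integrableOn_sinh_mul_sinh ν hx).const_mul ν
    have hle : ∫ t in Ioi (0 : ℝ), (x * (Real.exp (-x * Real.cosh t) * Real.cosh (ν * t))
          + ν * (Real.exp (-x * Real.cosh t) * (Real.sinh t * Real.sinh (ν * t))))
        ≤ ∫ t in Ioi (0 : ℝ), R * (Real.exp (-x * Real.cosh t) *
          (Real.cosh t * Real.cosh (ν * t))) := by
      refine setIntegral_mono_on (hiK.add hiB) hiA measurableSet_Ioi fun t ht => ?_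
      have hs : 0 ≤ Real.sinh t := Real.sinh_nonneg_iff.2 (le_of_lt ht)
      have h1 : x + |ν| * Real.sinh t ≤ R * Real.cosh t := by
        refine abs_le_of_sq_le_sq' ?_ (mul_pos hR0 (Real.cosh_pos t)).le |>.2
        rw [mul_pow, ← hR, Real.cosh_sq]
        nlinarith [sq_nonneg (x * Real.sinh t - |ν|), sq_abs ν]
      have h2 : ν * Real.sinh (ν * t) ≤ |ν| * Real.cosh (ν * t) := by
        refine (le_abs_self _).trans ?_
        rw [abs_mul]
        exact mul_le_mul_of_nonneg_left (abs_sinh_le_cosh _) (abs_nonneg _)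
      have h3 : x * Real.cosh (ν * t) + ν * (Real.sinh t * Real.sinh (ν * t))
          ≤ R * (Real.cosh t * Real.cosh (ν * t)) := by
        have := mul_le_mul_of_nonneg_right h1 (Real.cosh_pos (ν * t)).le
        have := mul_le_mul_of_nonneg_left h2 hs
        linarith
      have := mul_le_mul_of_nonneg_left h3 (Real.exp_pos (-x * Real.cosh t)).le
      linarith
    rw [integral_add hiK hiB, integral_const_mul, integral_const_mul, integral_const_mul,
      ← hK] at hle
    have h4 := mul_le_mul_of_nonneg_left hle hx.le
    refine le_of_mul_le_mul_left ?_ hR0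
    have h5 : R * (R * besselK ν x) = (x ^ 2 + ν ^ 2) * besselK ν x := by rw [hR]; ring
    rw [h5]
    linear_combination h4 - ν * hB
  · have hB := mul_integral_sinh_mul_sinh ν hx
    have hK : besselK ν x
      = ∫ t in Ioi (0 : ℝ), Real.exp (-x * Real.cosh t) * Real.cosh (ν * t) := rfl
    have hiA := integrableOn_cosh_mul_cosh ν hx
    have hiK := integrableOn_besselK ν hx
    have hiB := integrableOn_sinh_mul_sinh ν hx
    have hle : ∫ t in Ioi (0 : ℝ), Real.exp (-x * Real.cosh t) *
          (Real.cosh t * Real.cosh (ν * t))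
        ≤ ∫ t in Ioi (0 : ℝ), (Real.exp (-x * Real.cosh t) * Real.cosh (ν * t)
          + Real.exp (-x * Real.cosh t) * (Real.sinh t * Real.sinh (ν * t))) := by
      refine setIntegral_mono_on hiA (hiK.add hiB) measurableSet_Ioi fun t ht => ?_
      have ht0 : 0 ≤ t := le_of_lt ht
      have h1 : Real.cosh (ν * t - t) ≤ Real.cosh (ν * t) := by
        rw [Real.cosh_le_cosh, abs_of_nonneg (by positivity : 0 ≤ ν * t), abs_le]
        constructor <;> nlinarith
      rw [Real.cosh_sub] at h1
      have := mul_le_mul_of_nonneg_left h1 (Real.exp_pos (-x * Real.cosh t)).le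
      linarith
    rw [integral_add hiK hiB, ← hK] at hle
    have h4 := mul_le_mul_of_nonneg_left hle hx.le
    linear_combination h4 + hB

end BesselK

section Product

variable {ν x : ℝ}

lemma exists_hasDerivAt_besselI_mul_besselK (hν : -1 < ν) (hx : 0 < x) :
    ∃ d, HasDerivAt (fun z => besselI ν z * besselK ν z) d x ∧ d ≤ 0 ∧
      (1 / 2 ≤ ν → -d ≤ besselI ν x * besselK ν x) := by
  obtain ⟨dI, hI, hI1, hI2⟩ := exists_hasDerivAt_besselI hν hx
  obtain ⟨dK, hK, hK1, hK2⟩ := exists_hasDerivAt_besselK ν hx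
  have hI0 := besselI_nonneg hν hx
  have hK0 := besselK_nonneg ν x
  refine ⟨_, hI.mul hK, ?_, fun h => ?_⟩
  · have h1 := mul_le_mul_of_nonneg_right hI2 hK0
    have h2 := mul_le_mul_of_nonneg_left hK1 hI0
    refine nonpos_of_mul_nonpos_right (a := x) ?_ hx
    linarith
  · have h1 := mul_le_mul_of_nonneg_right hI1 hK0
    have h2 := mul_le_mul_of_nonneg_left (hK2 h) hI0
    refine le_of_mul_le_mul_left ?_ hx
    linarith

lemma antitoneOn_besselI_mul_besselK (hν : -1 < ν) :
    AntitoneOn (fun z => besselI ν z * besselK ν z) (Ioi 0) := by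
  have h := fun x (hx : x ∈ Ioi (0 : ℝ)) => exists_hasDerivAt_besselI_mul_besselK hν hx
  choose! d hd hd0 _ using h
  refine antitoneOn_of_hasDerivWithinAt_nonpos (f' := d) (convex_Ioi 0)
    (fun x hx => (hd x hx).continuousAt.continuousWithinAt) ?_ ?_ <;> rw [interior_Ioi]
  · exact fun x hx => (hd x hx).hasDerivWithinAt
  · exact hd0

lemma monotoneOn_mul_besselI_mul_besselK (hν : 1 / 2 ≤ ν) :
    MonotoneOn (fun z => z * (besselI ν z * besselK ν z)) (Ioc 0 1) := by
  have h := fun x (hx : x ∈ Ioi (0 : ℝ)) =>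
    exists_hasDerivAt_besselI_mul_besselK (by linarith : -1 < ν) hx
  choose! d hd _ hd1 using h
  have hd' := fun x (hx : x ∈ Ioc (0 : ℝ) 1) => (hasDerivAt_id x).mul (hd x hx.1)
  refine monotoneOn_of_hasDerivWithinAt_nonneg (convex_Ioc 0 1)
    (fun x hx => (hd' x hx).continuousAt.continuousWithinAt)
    (fun x hx => (hd' x (interior_subset hx)).hasDerivWithinAt) fun x hx => ?_
  have hx : x ∈ Ioc (0 : ℝ) 1 := interior_subset hx
  have hx0 : 0 < x := hx.1
  have h1 := mul_le_mul_of_nonneg_left (hd1 x hx0 hν) hx0.le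
  have h2 := mul_le_mul_of_nonneg_right hx.2
    (mul_nonneg (besselI_nonneg (by linarith : -1 < ν) hx0) (besselK_nonneg ν x))
  simp only [id]
  linarith

lemma monotoneOn_besselI_mul_besselK_add_log (hν : 1 / 2 ≤ ν) :
    MonotoneOn (fun z => besselI ν z * besselK ν z + besselI ν 1 * besselK ν 1 * Real.log z)
      (Ioc 0 1) := by
  have h := fun x (hx : x ∈ Ioi (0 : ℝ)) =>
    exists_hasDerivAt_besselI_mul_besselK (by linarith : -1 < ν) hx
  choose! d hd _ hd1 using h
  have hd' := fun x (hx : x ∈ Ioc (0 : ℝ) 1) => (hd x hx.1).add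
    ((Real.hasDerivAt_log hx.1.ne').const_mul (besselI ν 1 * besselK ν 1))
  refine monotoneOn_of_hasDerivWithinAt_nonneg (convex_Ioc 0 1)
    (fun x hx => (hd' x hx).continuousAt.continuousWithinAt)
    (fun x hx => (hd' x (interior_subset hx)).hasDerivWithinAt) fun x hx => ?_
  have hx : x ∈ Ioc (0 : ℝ) 1 := interior_subset hx
  have hx0 : 0 < x := hx.1
  have h1 : x * (besselI ν x * besselK ν x) ≤ 1 * (besselI ν 1 * besselK ν 1) :=
    monotoneOn_mul_besselI_mul_besselK hν hx (by simp) hx.2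
  have h2 := mul_le_mul_of_nonneg_left (hd1 x hx0 hν) hx0.le
  refine nonneg_of_mul_nonneg_right (a := x) ?_ hx0
  field_simp
  linarith

end Product

theorem stmt13 :
    (∀ ν x : ℝ, 1 / 2 ≤ ν → x ∈ Ioc (0 : ℝ) 1 →
        besselI ν x * besselK ν x / (1 + |Real.log x|) ≤ besselI ν 1 * besselK ν 1) ∧
    (∀ ν x : ℝ, -1 < ν → 1 ≤ x →
        besselI ν x * besselK ν x / (1 + |Real.log x|) ≤ besselI ν 1 * besselK ν 1) := by
  refine ⟨fun ν x hν hx => ?_, fun ν x hν hx => ?_⟩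
  · have h := monotoneOn_besselI_mul_besselK_add_log hν hx (by simp : (1 : ℝ) ∈ Ioc 0 1) hx.2
    simp only [Real.log_one, mul_zero, add_zero] at h
    rw [div_le_iff₀ (by positivity), abs_of_nonpos (Real.log_nonpos hx.1.le hx.2)]
    linarith
  · have hx0 : 0 < x := by linarith
    have h : besselI ν x * besselK ν x ≤ besselI ν 1 * besselK ν 1 :=
      antitoneOn_besselI_mul_besselK hν (by simp : (1 : ℝ) ∈ Ioi 0) hx0 hx
    refine le_trans (div_le_self (mul_nonneg (besselI_nonneg hν hx0) (besselK_nonneg ν x)) ?_) h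
    linarith [abs_nonneg (Real.log x)]
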